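/- arXiv:2104.10006 — 4 statements merged into one kernel-verified Lean document; each statement's English description precedes it below -/
import Mathlib

section
/- For any real exponent α ≥ 2, the function f(x,y) = y^α / x is convex on the set {(x,y) ∈ ℝ × ℝ : x > 0 and y > 0}. -/
/-- Lemma 2: for α ≥ 2, f(x,y) = y^α / x is convex on {(x,y) : x > 0, y > 0}. -/
theorem stmt_0 (α : ℝ) (hα : 2 ≤ α) :
    ConvexOn ℝ {p : ℝ × ℝ | 0 < p.1 ∧ 0 < p.2}
      (fun p : ℝ × ℝ => p.2 ^ α / p.1) := by
  have hpow : ∀ y : ℝ, 0 < y → y ^ α = (y ^ (α / 2)) ^ 2 := by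
    intro y hy
    rw [← Real.rpow_natCast, ← Real.rpow_mul hy.le]
    congr 1
    push_cast
    ring
  have hS : Convex ℝ {p : ℝ × ℝ | 0 < p.1 ∧ 0 < p.2} := by
    have h := (convex_Ioi (𝕜 := ℝ) (0 : ℝ)).prod (convex_Ioi (𝕜 := ℝ) (0 : ℝ))
    exact h
  refine ⟨hS, ?_⟩
  intro p hp q hq a b ha hb hab
  have hm := hS hp hq ha hb hab
  obtain ⟨x₁, y₁⟩ := p
  obtain ⟨x₂, y₂⟩ := q
  have hx₁ : 0 < x₁ := hp.1
  have hy₁ : 0 < y₁ := hp.2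
  have hx₂ : 0 < x₂ := hq.1
  have hy₂ : 0 < y₂ := hq.2
  have hX : 0 < a * x₁ + b * x₂ := hm.1
  have hY : 0 < a * y₁ + b * y₂ := hm.2
  change (a * y₁ + b * y₂) ^ α / (a * x₁ + b * x₂) ≤ a * (y₁ ^ α / x₁) + b * (y₂ ^ α / x₂)
  have hc : (a * y₁ + b * y₂) ^ (α / 2) ≤ a * y₁ ^ (α / 2) + b * y₂ ^ (α / 2) :=
    (convexOn_rpow (p := α / 2) (by linarith)).2 (Set.mem_Ici.2 hy₁.le) (Set.mem_Ici.2 hy₂.le)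
      ha hb hab
  have hw : 0 ≤ (a * y₁ + b * y₂) ^ (α / 2) := Real.rpow_nonneg hY.le _
  rw [hpow _ hY, hpow _ hy₁, hpow _ hy₂, div_le_iff₀ hX]
  generalize (a * y₁ + b * y₂) ^ (α / 2) = w at *
  generalize y₁ ^ (α / 2) = u at *
  generalize y₂ ^ (α / 2) = v at *
  have h1 : w ^ 2 ≤ (a * u + b * v) ^ 2 := pow_le_pow_left₀ hw hc 2
  have h2 : (a * (u ^ 2 / x₁) + b * (v ^ 2 / x₂)) * (a * x₁ + b * x₂)
      = (a * u + b * v) ^ 2 + a * b * (u * x₂ - v * x₁) ^ 2 / (x₁ * x₂) := by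
    field_simp
    ring
  have h3 : 0 ≤ a * b * (u * x₂ - v * x₁) ^ 2 / (x₁ * x₂) := by positivity
  linarith
end

section
/- For any real exponent α ≥ 2, the set {(x,y,z) ∈ ℝ³ : x > 0, y > 0, and y^α / x ≤ z} is a convex subset of ℝ³. -/
lemma aux_tangent (u x t : ℝ) (hx : 0 < x) : 2 * t * u - t ^ 2 * x ≤ u ^ 2 / x := by
  rw [le_div_iff₀ hx]
  nlinarith [sq_nonneg (u - t * x)]

lemma aux_sq (α y : ℝ) (hy : 0 < y) : y ^ α = (y ^ (α / 2)) ^ 2 := by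
  rw [← Real.rpow_natCast, ← Real.rpow_mul hy.le]
  congr 1
  push_cast
  ring

/-- Epigraph form of Lemma 2: for α ≥ 2, {(x,y,z) : x > 0, y > 0, y^α/x ≤ z} is convex. -/
theorem stmt_1 (α : ℝ) (hα : 2 ≤ α) :
    Convex ℝ {p : ℝ × ℝ × ℝ | 0 < p.1 ∧ 0 < p.2.1 ∧ p.2.1 ^ α / p.1 ≤ p.2.2} := by
  rintro ⟨x₁, y₁, z₁⟩ ⟨hx₁, hy₁, hz₁⟩ ⟨x₂, y₂, z₂⟩ ⟨hx₂, hy₂, hz₂⟩ a b ha hb hab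
  simp only at hx₁ hy₁ hz₁ hx₂ hy₂ hz₂
  have hX : 0 < a * x₁ + b * x₂ := (convex_Ioi (0 : ℝ)) hx₁ hx₂ ha hb hab
  have hY : 0 < a * y₁ + b * y₂ := (convex_Ioi (0 : ℝ)) hy₁ hy₂ ha hb hab
  refine ⟨hX, hY, ?_⟩
  change (a * y₁ + b * y₂) ^ α / (a * x₁ + b * x₂) ≤ a * z₁ + b * z₂
  have hc : (a * y₁ + b * y₂) ^ (α / 2) ≤ a * y₁ ^ (α / 2) + b * y₂ ^ (α / 2) :=
    (convexOn_rpow (p := α / 2) (by linarith)).2 hy₁.le hy₂.le ha hb hab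
  have hp : 0 ≤ (a * y₁ + b * y₂) ^ (α / 2) := by positivity
  rw [aux_sq α _ hy₁] at hz₁
  rw [aux_sq α _ hy₂] at hz₂
  rw [aux_sq α _ hY]
  set u := y₁ ^ (α / 2)
  set v := y₂ ^ (α / 2)
  set w := (a * y₁ + b * y₂) ^ (α / 2)
  set X := a * x₁ + b * x₂ with hXd
  obtain ⟨t, ht⟩ : ∃ t, t = w / X := ⟨_, rfl⟩
  have ht0 : 0 ≤ t := by rw [ht]; positivity
  have hw : w = t * X := by rw [ht]; field_simp
  have e : w ^ 2 / X = 2 * t * w - t ^ 2 * X := by rw [hw]; field_simp; ring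
  have h1 := mul_le_mul_of_nonneg_left ((aux_tangent u x₁ t hx₁).trans hz₁) ha
  have h2 := mul_le_mul_of_nonneg_left ((aux_tangent v x₂ t hx₂).trans hz₂) hb
  have h3 := mul_le_mul_of_nonneg_left hc ht0
  rw [e, hXd]
  linarith
end

section
/- Let α > 0, γ_t > 0, γ_r > 0 be real numbers, let a, b, β_t, β_r, D_t, D_r be positive reals, and set C' = 2^{γ_r}(2^{γ_t} − 1)/(2^{γ_r} − 1). If (β_t/β_r)² = C' · (a/b) · (D_t/D_r)^α, then the inequality β_r/(b · D_r^α) ≤ β_t/(a · D_t^α) holds if and only if β_t ≤ C' · β_r. -/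
/-- Lemma 1, decoding order λ(t) = 1: under the KKT ratio relation, the channel-gain
ordering constraint is equivalent to the linear constraint β_t ≤ C' β_r. -/
theorem stmt_4 (α γt γr a b βt βr Dt Dr : ℝ)
    (hα : 0 < α) (hγt : 0 < γt) (hγr : 0 < γr)
    (ha : 0 < a) (hb : 0 < b) (hβt : 0 < βt) (hβr : 0 < βr)
    (hDt : 0 < Dt) (hDr : 0 < Dr)
    (hratio : (βt / βr) ^ 2
        = ((2 : ℝ) ^ γr * ((2 : ℝ) ^ γt - 1) / ((2 : ℝ) ^ γr - 1)) * (a / b) * (Dt / Dr) ^ α) :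
    βr / (b * Dr ^ α) ≤ βt / (a * Dt ^ α)
      ↔ βt ≤ ((2 : ℝ) ^ γr * ((2 : ℝ) ^ γt - 1) / ((2 : ℝ) ^ γr - 1)) * βr := by
  have h1 : (1 : ℝ) < 2 ^ γr := Real.one_lt_rpow (by norm_num) hγr
  have h2 : (1 : ℝ) < 2 ^ γt := Real.one_lt_rpow (by norm_num) hγt
  have hC : 0 < (2 : ℝ) ^ γr * ((2 : ℝ) ^ γt - 1) / ((2 : ℝ) ^ γr - 1) :=
    div_pos (mul_pos (by linarith) (by linarith)) (by linarith)
  generalize (2 : ℝ) ^ γr * ((2 : ℝ) ^ γt - 1) / ((2 : ℝ) ^ γr - 1) = C at *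
  rw [Real.div_rpow hDt.le hDr.le] at hratio
  have hx : 0 < Dt ^ α := Real.rpow_pos_of_pos hDt α
  have hy : 0 < Dr ^ α := Real.rpow_pos_of_pos hDr α
  generalize Dt ^ α = x at *
  generalize Dr ^ α = y at *
  have key : βt ^ 2 * (b * y) = C * a * x * βr ^ 2 := by
    have e : C * a * x * βr ^ 2 = (C * (a / b) * (x / y)) * (βr ^ 2 * (b * y)) := by
      field_simp
    rw [e, ← hratio]
    field_simp
  rw [div_le_div_iff₀ (by positivity) (by positivity)]
  have hp : 0 < C * βr := by positivity
  have hq : 0 < βt * (b * y) := by positivity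
  rw [← mul_le_mul_iff_right₀ hp, ← mul_le_mul_iff_right₀ (b := βt) hq]
  have e1 : C * βr * (βr * (a * x)) = βt * (b * y) * βt := by linear_combination -key
  have e2 : C * βr * (βt * (b * y)) = βt * (b * y) * (C * βr) := by ring
  rw [e1, e2]
end

section
/- Let α ≥ 2, let A_t, A_r, P > 0 and μ_t, μ_r ≥ 0 be real constants. Then the set of tuples (β_t, β_r, D_t, D_r, D₀) ∈ ℝ⁵ satisfying: β_t > 0, β_r > 0, β_t + β_r = 1, D_t ≥ 1, D_r ≥ 1, D_t ≥ μ_t D₀, D_r ≥ μ_r D₀, A_t · D_t^α / β_t − P β_t ≤ 0, and A_r · D_r^α / β_r − P β_r ≤ 0, is a convex subset of ℝ⁵. -/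
lemma aux_iff (α A P b D : ℝ) (hA : 0 < A) (hP : 0 < P) (hb : 0 < b) (hD : 1 ≤ D) :
    A * D ^ α / b - P * b ≤ 0 ↔ √A * D ^ (α / 2) ≤ √P * b := by
  have hD0 : 0 ≤ D := by linarith
  have e : D ^ α = (D ^ (α / 2)) ^ 2 := by
    rw [← Real.rpow_natCast, ← Real.rpow_mul hD0]
    congr 1
    push_cast
    ring
  have hE : 0 ≤ D ^ (α / 2) := Real.rpow_nonneg hD0 _
  rw [sub_nonpos, div_le_iff₀ hb, e,
    ← sq_le_sq₀ (mul_nonneg (Real.sqrt_nonneg A) hE) (mul_nonneg (Real.sqrt_nonneg P) hb.le),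
    mul_pow, mul_pow, Real.sq_sqrt hA.le, Real.sq_sqrt hP.le, sq b, mul_assoc P b b]

lemma aux_conv (α A P b D b' D' s t : ℝ) (hα : 2 ≤ α) (hA : 0 < A) (hP : 0 < P)
    (hb : 0 < b) (hD : 1 ≤ D) (hb' : 0 < b') (hD' : 1 ≤ D')
    (hs : 0 ≤ s) (ht : 0 ≤ t) (hst : s + t = 1)
    (hB : 0 < s * b + t * b') (hE : 1 ≤ s * D + t * D')
    (h : A * D ^ α / b - P * b ≤ 0) (h' : A * D' ^ α / b' - P * b' ≤ 0) :
    A * (s * D + t * D') ^ α / (s * b + t * b') - P * (s * b + t * b') ≤ 0 := by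
  rw [aux_iff _ _ _ _ _ hA hP hb hD] at h
  rw [aux_iff _ _ _ _ _ hA hP hb' hD'] at h'
  rw [aux_iff _ _ _ _ _ hA hP hB hE]
  have c := (convexOn_rpow (p := α / 2) (by linarith)).2
    (show D ∈ Set.Ici (0:ℝ) from zero_le_one.trans hD)
    (show D' ∈ Set.Ici (0:ℝ) from zero_le_one.trans hD') hs ht hst
  simp only [smul_eq_mul] at c
  have c2 := mul_le_mul_of_nonneg_left c (Real.sqrt_nonneg A)
  have h1 := mul_le_mul_of_nonneg_left h hs
  have h2 := mul_le_mul_of_nonneg_left h' ht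
  linarith

/-- Convexity of the feasible set of the OMA subproblem (14) with fixed resource
allocation. Coordinates: (β_t, β_r, D_t, D_r, D₀). -/
theorem stmt_13 (α At Ar P μt μr : ℝ)
    (hα : 2 ≤ α) (hAt : 0 < At) (hAr : 0 < Ar) (hP : 0 < P)
    (hμt : 0 ≤ μt) (hμr : 0 ≤ μr) :
    Convex ℝ {v : ℝ × ℝ × ℝ × ℝ × ℝ |
      0 < v.1 ∧ 0 < v.2.1 ∧ v.1 + v.2.1 = 1 ∧
      1 ≤ v.2.2.1 ∧ 1 ≤ v.2.2.2.1 ∧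
      μt * v.2.2.2.2 ≤ v.2.2.1 ∧ μr * v.2.2.2.2 ≤ v.2.2.2.1 ∧
      At * v.2.2.1 ^ α / v.1 - P * v.1 ≤ 0 ∧
      Ar * v.2.2.2.1 ^ α / v.2.1 - P * v.2.1 ≤ 0} := by
  rintro ⟨a, b, c, d, e⟩ ⟨h1, h2, h3, h4, h5, h6, h7, h8, h9⟩ ⟨a', b', c', d', e'⟩
    ⟨k1, k2, k3, k4, k5, k6, k7, k8, k9⟩ s t hs ht hst
  simp only at h1 h2 h3 h4 h5 h6 h7 h8 h9 k1 k2 k3 k4 k5 k6 k7 k8 k9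
  have pos : ∀ x y : ℝ, 0 < x → 0 < y → 0 < s * x + t * y := fun x y hx hy =>
    (convex_Ioi (0:ℝ)) (Set.mem_Ioi.2 hx) (Set.mem_Ioi.2 hy) hs ht hst
  have one : ∀ x y : ℝ, 1 ≤ x → 1 ≤ y → 1 ≤ s * x + t * y := fun x y hx hy =>
    (convex_Ici (1:ℝ)) (Set.mem_Ici.2 hx) (Set.mem_Ici.2 hy) hs ht hst
  simp only [Set.mem_setOf_eq, Prod.smul_mk, Prod.mk_add_mk, smul_eq_mul]
  refine ⟨pos _ _ h1 k1, pos _ _ h2 k2, ?_, one _ _ h4 k4, one _ _ h5 k5, ?_, ?_, ?_, ?_⟩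
  · linear_combination s * h3 + t * k3 + hst
  · linarith [mul_le_mul_of_nonneg_left h6 hs, mul_le_mul_of_nonneg_left k6 ht]
  · linarith [mul_le_mul_of_nonneg_left h7 hs, mul_le_mul_of_nonneg_left k7 ht]
  · exact aux_conv α At P a c a' c' s t hα hAt hP h1 h4 k1 k4 hs ht hst (pos _ _ h1 k1)
      (one _ _ h4 k4) h8 k8
  · exact aux_conv α Ar P b d b' d' s t hα hAr hP h2 h5 k2 k5 hs ht hst (pos _ _ h2 k2)
      (one _ _ h5 k5) h9 k9
end
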